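/- Let $A$ be an algebraic ring over an algebraically closed field $K$ which is a division ring as an abstract ring (i.e., $A^{\times} = A \setminus \{0\}$). Then $\dim A \leq 1$ as an algebraic variety. -/

import Mathlib

noncomputable section

open MvPolynomial

/-- The Zariski topology on affine `n`-space over `K`. -/
def affineZariski (K : Type) [Field K] (n : ℕ) : TopologicalSpace (Fin n → K) :=
  TopologicalSpace.generateFrom
    {U | ∃ p : MvPolynomial (Fin n) K, U = {x | MvPolynomial.eval x p ≠ 0}}

/-- An algebraic ring over `K`: a Zariski-closed subset of some affine space `K^n`
equipped with regular (polynomial) addition, negation and multiplication maps making it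
into a unital ring whose additive group is a commutative algebraic group. -/
structure AlgebraicRing (K : Type) [Field K] where
  n : ℕ
  carrier : Set (Fin n → K)
  carrier_closed : ∃ S : Set (MvPolynomial (Fin n) K),
    carrier = {x | ∀ p ∈ S, MvPolynomial.eval x p = 0}
  add : (Fin n → K) → (Fin n → K) → Fin n → K
  mul : (Fin n → K) → (Fin n → K) → Fin n → K
  neg : (Fin n → K) → Fin n → K
  zero : Fin n → K
  one : Fin n → K
  add_poly : ∃ P : Fin n → MvPolynomial (Fin n ⊕ Fin n) K,
    ∀ x y : Fin n → K, ∀ i, add x y i = MvPolynomial.eval (Sum.elim x y) (P i)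
  mul_poly : ∃ P : Fin n → MvPolynomial (Fin n ⊕ Fin n) K,
    ∀ x y : Fin n → K, ∀ i, mul x y i = MvPolynomial.eval (Sum.elim x y) (P i)
  neg_poly : ∃ P : Fin n → MvPolynomial (Fin n) K,
    ∀ x : Fin n → K, ∀ i, neg x i = MvPolynomial.eval x (P i)
  zero_mem : zero ∈ carrier
  one_mem : one ∈ carrier
  add_mem : ∀ {x y}, x ∈ carrier → y ∈ carrier → add x y ∈ carrier
  mul_mem : ∀ {x y}, x ∈ carrier → y ∈ carrier → mul x y ∈ carrier
  neg_mem : ∀ {x}, x ∈ carrier → neg x ∈ carrier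
  add_comm' : ∀ x ∈ carrier, ∀ y ∈ carrier, add x y = add y x
  add_assoc' : ∀ x ∈ carrier, ∀ y ∈ carrier, ∀ z ∈ carrier,
    add (add x y) z = add x (add y z)
  zero_add' : ∀ x ∈ carrier, add zero x = x
  neg_add_cancel' : ∀ x ∈ carrier, add (neg x) x = zero
  mul_assoc' : ∀ x ∈ carrier, ∀ y ∈ carrier, ∀ z ∈ carrier,
    mul (mul x y) z = mul x (mul y z)
  one_mul' : ∀ x ∈ carrier, mul one x = x
  mul_one' : ∀ x ∈ carrier, mul x one = x
  left_distrib' : ∀ x ∈ carrier, ∀ y ∈ carrier, ∀ z ∈ carrier,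
    mul x (add y z) = add (mul x y) (mul x z)
  right_distrib' : ∀ x ∈ carrier, ∀ y ∈ carrier, ∀ z ∈ carrier,
    mul (add x y) z = add (mul x z) (mul y z)

namespace AlgebraicRing

variable {K : Type} [Field K] (A : AlgebraicRing K)

/-- The points of the algebraic ring `A`. -/
def Elt : Type := {x : Fin A.n → K // x ∈ A.carrier}

instance : TopologicalSpace A.Elt :=
  TopologicalSpace.induced (fun x => x.1) (affineZariski K A.n)

instance : Add A.Elt := ⟨fun x y => ⟨A.add x.1 y.1, A.add_mem x.2 y.2⟩⟩
instance : Mul A.Elt := ⟨fun x y => ⟨A.mul x.1 y.1, A.mul_mem x.2 y.2⟩⟩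
instance : Neg A.Elt := ⟨fun x => ⟨A.neg x.1, A.neg_mem x.2⟩⟩
instance : Zero A.Elt := ⟨⟨A.zero, A.zero_mem⟩⟩
instance : One A.Elt := ⟨⟨A.one, A.one_mem⟩⟩

instance : AddCommGroup A.Elt where
  add_assoc a b c := Subtype.ext (A.add_assoc' _ a.2 _ b.2 _ c.2)
  zero_add a := Subtype.ext (A.zero_add' _ a.2)
  add_zero a := Subtype.ext (by
    show A.add a.1 A.zero = a.1
    rw [A.add_comm' _ a.2 _ A.zero_mem]
    exact A.zero_add' _ a.2)
  neg_add_cancel a := Subtype.ext (A.neg_add_cancel' _ a.2)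
  add_comm a b := Subtype.ext (A.add_comm' _ a.2 _ b.2)
  nsmul := nsmulRec
  zsmul := zsmulRec

instance : Ring A.Elt :=
  { (inferInstance : AddCommGroup A.Elt) with
    left_distrib := fun a b c => Subtype.ext (A.left_distrib' _ a.2 _ b.2 _ c.2)
    right_distrib := fun a b c => Subtype.ext (A.right_distrib' _ a.2 _ b.2 _ c.2)
    zero_mul := fun a => by
      have h : (0 : A.Elt) * a + (0 : A.Elt) * a = (0 : A.Elt) * a + 0 := by
        rw [add_zero]
        apply Subtype.ext
        show A.add (A.mul A.zero a.1) (A.mul A.zero a.1) = A.mul A.zero a.1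
        rw [← A.right_distrib' _ A.zero_mem _ A.zero_mem _ a.2, A.zero_add' _ A.zero_mem]
      exact add_left_cancel h
    mul_zero := fun a => by
      have h : a * (0 : A.Elt) + a * (0 : A.Elt) = a * (0 : A.Elt) + 0 := by
        rw [add_zero]
        apply Subtype.ext
        show A.add (A.mul a.1 A.zero) (A.mul a.1 A.zero) = A.mul a.1 A.zero
        rw [← A.left_distrib' _ a.2 _ A.zero_mem _ A.zero_mem, A.zero_add' _ A.zero_mem]
      exact add_left_cancel h
    mul_assoc := fun a b c => Subtype.ext (A.mul_assoc' _ a.2 _ b.2 _ c.2)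
    one_mul := fun a => Subtype.ext (A.one_mul' _ a.2)
    mul_one := fun a => Subtype.ext (A.mul_one' _ a.2) }

end AlgebraicRing

/-- A commutative algebraic ring. -/
structure CommAlgebraicRing (K : Type) [Field K] extends AlgebraicRing K where
  mul_comm' : ∀ x ∈ carrier, ∀ y ∈ carrier, mul x y = mul y x

namespace CommAlgebraicRing

variable {K : Type} [Field K] (A : CommAlgebraicRing K)

/-- The points of the commutative algebraic ring `A`. -/
abbrev Elt : Type := A.toAlgebraicRing.Elt

instance : CommRing A.Elt :=
  { (inferInstance : Ring A.toAlgebraicRing.Elt) with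
    mul_comm := fun a b => Subtype.ext (by exact A.mul_comm' _ a.2 _ b.2) }

end CommAlgebraicRing

end


namespace AlgebraicRing

open MvPolynomial

variable {K : Type} [Field K] (A : AlgebraicRing K)

/-- The underlying point. -/
def pt (x : A.Elt) : Fin A.n → K := x.1

lemma pt_inj {x y : A.Elt} (h : A.pt x = A.pt y) : x = y := Subtype.ext h

lemma pt_mem (x : A.Elt) : A.pt x ∈ A.carrier := x.2

lemma eval_bind {σ τ : Type} (x : τ → K) (f : σ → MvPolynomial τ K) (p : MvPolynomial σ K) :
    eval x (bind₁ f p) = eval (fun i => eval x (f i)) p := by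
  induction p using MvPolynomial.induction_on with
  | C a => simp
  | add p q hp hq => simp [hp, hq]
  | mul_X p i hp => simp [hp]

lemma closed_zero (p : MvPolynomial (Fin A.n) K) :
    IsClosed {x : A.Elt | MvPolynomial.eval (A.pt x) p = 0} := by
  rw [← isOpen_compl_iff]
  refine (@isOpen_induced_iff _ _ (affineZariski K A.n) _ A.pt).mpr ⟨{x | MvPolynomial.eval x p ≠ 0}, ?_, ?_⟩
  · exact TopologicalSpace.isOpen_generateFrom_of_mem ⟨p, rfl⟩
  · ext x; simp

lemma exists_sep {Z : Set A.Elt} (hZ : IsClosed Z) {x : A.Elt} (hx : x ∉ Z) :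
    ∃ p : MvPolynomial (Fin A.n) K, eval (A.pt x) p ≠ 0 ∧ ∀ z ∈ Z, eval (A.pt z) p = 0 := by
  obtain ⟨U, hU, hUZ⟩ := (@isOpen_induced_iff _ _ (affineZariski K A.n) _ A.pt).mp hZ.isOpen_compl
  have key : ∀ y ∈ U, ∃ p : MvPolynomial (Fin A.n) K, eval y p ≠ 0 ∧
      ∀ z, z ∉ U → eval z p = 0 := by
    clear hUZ
    change TopologicalSpace.GenerateOpen _ U at hU
    induction hU with
    | basic s hs =>
      obtain ⟨p, rfl⟩ := hs
      exact fun y hy => ⟨p, hy, fun z hz => by simpa using hz⟩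
    | univ => exact fun y _ => ⟨1, by simp, fun z hz => absurd (Set.mem_univ z) hz⟩
    | inter s t _ _ hs ht =>
      intro y hy
      obtain ⟨p, hp, hp'⟩ := hs y hy.1
      obtain ⟨q, hq, hq'⟩ := ht y hy.2
      refine ⟨p * q, by simp [hp, hq], fun z hz => ?_⟩
      by_cases h : z ∈ s
      · have : z ∉ t := fun h' => hz ⟨h, h'⟩
        simp [hq' z this]
      · simp [hp' z h]
    | sUnion S _ ih =>
      rintro y ⟨s, hs, hys⟩
      obtain ⟨p, hp, hp'⟩ := ih s hs y hys
      exact ⟨p, hp, fun z hz => hp' z fun h => hz ⟨s, hs, h⟩⟩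
  have hxU : x ∈ A.pt ⁻¹' U := by rw [hUZ]; exact hx
  obtain ⟨p, hp, hp'⟩ := key (A.pt x) hxU
  refine ⟨p, hp, fun z hz => hp' _ fun h => ?_⟩
  have : z ∈ A.pt ⁻¹' U := h
  rw [hUZ] at this
  exact this hz

/-- functions obtained from polynomial in two groups of variables lie in a finite dimensional
space -/
lemma exists_fd {Y : Type} {n : ℕ} (c : Y → Fin n → K) (P : MvPolynomial (Fin n ⊕ Fin n) K) :
    ∃ W : Submodule K (Y → K), FiniteDimensional K W ∧
      ∀ x, (fun y => eval (Sum.elim x (c y)) P) ∈ W := by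
  induction P using MvPolynomial.induction_on with
  | C a =>
    refine ⟨Submodule.span K {fun _ => a}, inferInstance, fun x => ?_⟩
    simpa using Submodule.mem_span_singleton_self _
  | add p q hp hq =>
    obtain ⟨W, hW, h⟩ := hp
    obtain ⟨W', hW', h'⟩ := hq
    refine ⟨W ⊔ W', inferInstance, fun x => ?_⟩
    have := Submodule.add_mem_sup (h x) (h' x)
    convert this using 1
    ext y; simp
  | mul_X p i hp =>
    obtain ⟨W, hW, h⟩ := hp
    rcases i with i | i
    · refine ⟨W, hW, fun x => ?_⟩
      convert W.smul_mem (x i) (h x) using 1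
      ext y; simp [mul_comm]
    · refine ⟨W.map (LinearMap.mulLeft K (fun y => c y i)), inferInstance, fun x => ?_⟩
      refine ⟨_, h x, ?_⟩
      ext y; simp [mul_comm]

lemma exists_coord {Y : Type} {n : ℕ} (c : Y → Fin n → K) (P : MvPolynomial (Fin n ⊕ Fin n) K) :
    ∀ ψ : (Y → K) →ₗ[K] K, ∃ p : MvPolynomial (Fin n) K,
      ∀ x, ψ (fun y => eval (Sum.elim x (c y)) P) = eval x p := by
  induction P using MvPolynomial.induction_on with
  | C a => exact fun ψ => ⟨C (ψ fun _ => a), fun x => by simp⟩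
  | add p q hp hq =>
    intro ψ
    obtain ⟨r, hr⟩ := hp ψ
    obtain ⟨s, hs⟩ := hq ψ
    refine ⟨r + s, fun x => ?_⟩
    rw [map_add, ← hr, ← hs, ← map_add]
    congr 1
    ext y; simp
  | mul_X p i hp =>
    intro ψ
    rcases i with i | i
    · obtain ⟨r, hr⟩ := hp ψ
      refine ⟨X i * r, fun x => ?_⟩
      rw [map_mul, ← hr, eval_X, ← smul_eq_mul (x i), ← map_smul]
      congr 1
      ext y; simp [mul_comm]
    · obtain ⟨r, hr⟩ := hp (ψ ∘ₗ LinearMap.mulLeft K (fun y => c y i))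
      refine ⟨r, fun x => ?_⟩
      rw [← hr, LinearMap.comp_apply]
      congr 1
      ext y; simp [mul_comm]

lemma exists_comul (q : MvPolynomial (Fin A.n) K) : ∃ P : MvPolynomial (Fin A.n ⊕ Fin A.n) K,
    ∀ x y : A.Elt, eval (A.pt (x * y)) q = eval (Sum.elim (A.pt x) (A.pt y)) P := by
  obtain ⟨M, hM⟩ := A.mul_poly
  refine ⟨bind₁ M q, fun x y => ?_⟩
  have : A.pt (x * y) = fun i => eval (Sum.elim (A.pt x) (A.pt y)) (M i) := funext fun i => hM _ _ i
  rw [this, eval_bind]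

lemma exists_chi (h01 : (1 : A.Elt) ≠ 0) (hu : ∀ a : A.Elt, a ≠ 0 → IsUnit a) :
    ∃ p : MvPolynomial (Fin A.n) K, ∀ x : A.Elt, eval (A.pt x) p = 0 ↔ x = 0 := by
  obtain ⟨i, hi⟩ : ∃ i, A.pt 1 i ≠ A.pt 0 i := by
    by_contra! h
    exact h01 (A.pt_inj (funext h))
  let q : MvPolynomial (Fin A.n) K := X i - C (A.pt 0 i)
  let f : A.Elt → K := fun y => eval (A.pt y) q
  have hf0 : f 0 = 0 := by simp [f, q]
  have hf1 : f 1 ≠ 0 := by simpa [f, q, sub_eq_zero] using hi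
  let L : A.Elt → (A.Elt → K) →ₗ[K] (A.Elt → K) := fun x => LinearMap.funLeft K K (fun y => x * y)
  have hL : ∀ x v y, L x v y = v (x * y) := fun _ _ _ => rfl
  let V : Submodule K (A.Elt → K) := Submodule.span K (Set.range fun x => L x f)
  have hVL : ∀ x, ∀ v ∈ V, L x v ∈ V := by
    intro x v hv
    have : V ≤ V.comap (L x) := by
      refine Submodule.span_le.mpr ?_
      rintro _ ⟨z, rfl⟩
      refine Submodule.subset_span ⟨z * x, ?_⟩
      ext y; simp [hL, mul_assoc]
    exact this hv
  have hVp : ∀ v ∈ V, ∃ p : MvPolynomial (Fin A.n) K, ∀ y, v y = eval (A.pt y) p := by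
    intro v hv
    induction hv using Submodule.span_induction with
    | mem v h =>
      obtain ⟨x, rfl⟩ := h
      obtain ⟨P, hP⟩ := A.exists_comul q
      refine ⟨bind₁ (Sum.elim (fun i => C (A.pt x i)) X) P, fun y => ?_⟩
      change eval (A.pt (x * y)) q = _
      rw [hP, eval_bind]
      congr 2
      ext j
      rcases j with j | j <;> simp
    | zero => exact ⟨0, by simp⟩
    | add v w _ _ hv hw =>
      obtain ⟨r, hr⟩ := hv
      obtain ⟨s, hs⟩ := hw
      exact ⟨r + s, by simp [hr, hs]⟩
    | smul a v _ hv =>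
      obtain ⟨r, hr⟩ := hv
      exact ⟨C a * r, by simp [hr]⟩
  have hfd : FiniteDimensional K V := by
    obtain ⟨P, hP⟩ := A.exists_comul q
    obtain ⟨W, hW, h⟩ := exists_fd (A.pt) P
    refine Submodule.finiteDimensional_of_le (S₂ := W) (Submodule.span_le.mpr ?_)
    rintro _ ⟨x, rfl⟩
    have h2 := h (A.pt x)
    have h3 : (fun y => eval (Sum.elim (A.pt x) (A.pt y)) P) = L x f := by
      ext y
      exact (hP x y).symm
    rwa [h3] at h2
  have hfV : f ∈ V := Submodule.subset_span ⟨1, by ext y; simp [hL]⟩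
  let T : A.Elt → V →ₗ[K] V := fun x => (L x).restrict (hVL x)
  have hT : ∀ x v, (T x v).1 = L x v.1 := fun _ _ => rfl
  let b := Module.finBasis K V
  have hent : ∀ i j, ∃ p : MvPolynomial (Fin A.n) K, ∀ x : A.Elt,
      LinearMap.toMatrix b b (T x) i j = eval (A.pt x) p := by
    intro i j
    obtain ⟨ψ, hψ⟩ := LinearMap.exists_extend (b.coord i)
    obtain ⟨r, hr⟩ := hVp (b j).1 (b j).2
    obtain ⟨P, hP⟩ := A.exists_comul r
    obtain ⟨p, hp⟩ := exists_coord (A.pt) P ψ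
    refine ⟨p, fun x => ?_⟩
    rw [LinearMap.toMatrix_apply, ← hp, ← Module.Basis.coord_apply, ← hψ]
    rw [LinearMap.comp_apply]
    congr 1
    ext y
    change (b j).1 (x * y) = _
    rw [hr, hP]
  choose p hp using hent
  refine ⟨Matrix.det (Matrix.of p), fun x => ?_⟩
  have hdet : eval (A.pt x) (Matrix.det (Matrix.of p)) = LinearMap.det (T x) := by
    rw [← LinearMap.det_toMatrix b, RingHom.map_det]
    congr 1
    ext i j
    simp [hp]
  rw [hdet, LinearMap.det_eq_zero_iff_ker_ne_bot]
  constructor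
  · contrapose!
    intro hx
    rw [LinearMap.ker_eq_bot']
    intro v hv
    obtain ⟨u, rfl⟩ := hu x hx
    apply Subtype.ext
    ext y
    have := congrFun (congrArg Subtype.val hv) (↑u⁻¹ * y)
    rw [hT, hL] at this
    simpa using this
  · rintro rfl h
    rw [LinearMap.ker_eq_bot'] at h
    have := h ⟨f, hfV⟩ (by
      apply Subtype.ext
      ext y
      rw [hT, hL]
      simpa using hf0)
    exact hf1 (congrFun (congrArg Subtype.val this) 1)

lemma exists_chi_at (h01 : (1 : A.Elt) ≠ 0) (hu : ∀ a : A.Elt, a ≠ 0 → IsUnit a) (z : A.Elt) :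
    ∃ p : MvPolynomial (Fin A.n) K, ∀ x : A.Elt, eval (A.pt x) p = 0 ↔ x = z := by
  obtain ⟨p, hp⟩ := A.exists_chi h01 hu
  obtain ⟨M, hM⟩ := A.add_poly
  refine ⟨bind₁ (fun i => bind₁ (Sum.elim X (fun i => C (A.pt (-z) i))) (M i)) p, fun x => ?_⟩
  have h1 : A.pt (x + -z) = fun i => eval (A.pt x) (bind₁ (Sum.elim X (fun i => C (A.pt (-z) i))) (M i)) := by
    funext i
    refine (hM (A.pt x) (A.pt (-z)) i).trans ?_
    rw [eval_bind]
    congr 2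
    ext j
    rcases j with j | j <;> simp
  have h2 := hp (x + -z)
  rw [h1, add_neg_eq_zero] at h2
  rw [← h2, eval_bind]

/-- Vanishing ideal of a subset of `A`. -/
def vI (Z : Set A.Elt) : Ideal (MvPolynomial (Fin A.n) K) :=
  MvPolynomial.vanishingIdeal K (A.pt '' Z)

lemma mem_vI {Z : Set A.Elt} {p : MvPolynomial (Fin A.n) K} :
    p ∈ A.vI Z ↔ ∀ z ∈ Z, eval (A.pt z) p = 0 := by
  simp only [vI, mem_vanishingIdeal_iff, Set.forall_mem_image, aeval_eq_eval]

lemma vI_prime {Z : Set A.Elt} (hZ : IsIrreducible Z) : (A.vI Z).IsPrime := by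
  refine ⟨?_, ?_⟩
  · rw [Ideal.ne_top_iff_one, mem_vI]
    obtain ⟨z, hz⟩ := hZ.1
    intro h
    simpa using h z hz
  · intro p q hpq
    simp only [mem_vI] at *
    exact isPreirreducible_iff_isClosed_union_isClosed.mp hZ.2 _ _ (A.closed_zero p)
      (A.closed_zero q) fun z hz => by
        have := hpq z hz
        rw [map_mul, mul_eq_zero] at this
        exact this

lemma vI_lt {Z W : Set A.Elt} (hZ : IsClosed Z) (h : Z ⊂ W) : A.vI W < A.vI Z := by
  refine lt_of_le_not_ge (fun p hp => ?_) fun hle => ?_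
  · rw [mem_vI] at *
    exact fun z hz => hp z (h.1 hz)
  · obtain ⟨x, hxW, hxZ⟩ := Set.exists_of_ssubset h
    obtain ⟨p, hp, hp'⟩ := A.exists_sep hZ hxZ
    exact hp (A.mem_vI.mp (hle (A.mem_vI.mpr hp')) x hxW)

end AlgebraicRing

/-- An algebraic division ring over an algebraically closed field (a nonzero
algebraic ring whose units are exactly the nonzero elements) has dimension at most `1`
as an algebraic variety. -/
theorem stmt_3 (K : Type) [Field K] [IsAlgClosed K] (A : AlgebraicRing K)
    (hdiv : {a : A.Elt | IsUnit a} = {a : A.Elt | a ≠ 0}) :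
    topologicalKrullDim A.Elt ≤ 1 := by
  have h01 : (1 : A.Elt) ≠ 0 := by
    have : (1 : A.Elt) ∈ {a : A.Elt | IsUnit a} := isUnit_one
    rw [hdiv] at this
    exact this
  have hu : ∀ a : A.Elt, a ≠ 0 → IsUnit a := by
    intro a ha
    have : a ∈ {a : A.Elt | a ≠ 0} := ha
    rw [← hdiv] at this
    exact this
  refine iSup_le fun l => ?_
  by_contra hl
  have hl2 : 2 ≤ l.length := by
    by_contra h
    apply hl
    have : l.length ≤ 1 := by omega
    exact_mod_cast this
  let Z : ℕ → TopologicalSpace.IrreducibleCloseds A.Elt := fun k =>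
    l.toFun (Fin.ofNat _ k)
  have hlt01 : Z 0 < Z 1 := l.strictMono (by
    rw [Fin.lt_def]; simp only [Fin.ofNat]
    rw [Nat.mod_eq_of_lt (by omega), Nat.mod_eq_of_lt (by omega)]; omega)
  have hlt12 : Z 1 < Z 2 := l.strictMono (by
    rw [Fin.lt_def]; simp only [Fin.ofNat]
    rw [Nat.mod_eq_of_lt (by omega), Nat.mod_eq_of_lt (by omega)]; omega)
  obtain ⟨z, hz⟩ := (Z 0).isIrreducible'.1
  obtain ⟨χ, hχ⟩ := A.exists_chi_at h01 hu z
  have hs01 : (Z 0).carrier ⊂ (Z 1).carrier := hlt01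
  have hs12 : (Z 1).carrier ⊂ (Z 2).carrier := hlt12
  have hP0 := A.vI_prime (Z 0).isIrreducible'
  have hP1 := A.vI_prime (Z 1).isIrreducible'
  have hP2 := A.vI_prime (Z 2).isIrreducible'
  have h10 := A.vI_lt (Z 0).isClosed' hs01
  have h21 := A.vI_lt (Z 1).isClosed' hs12
  have hPm : (A.vI {z}).IsPrime := A.vI_prime isIrreducible_singleton
  have h0m : A.vI (Z 0).carrier ≤ A.vI {z} := fun p hp => by
    rw [A.mem_vI] at *
    rintro x rfl
    exact hp _ hz
  generalize hQ0 : A.vI (Z 0).carrier = Q0 at *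
  generalize hQ1 : A.vI (Z 1).carrier = Q1 at *
  have h1m : Q1 < A.vI {z} := lt_of_lt_of_le h10 h0m
  have hmin : A.vI {z} ∈ (A.vI (Z 2).carrier ⊔ Ideal.span {χ}).minimalPrimes := by
    refine ⟨⟨hPm, sup_le (h21.le.trans h1m.le) ?_⟩, ?_⟩
    · rw [Ideal.span_singleton_le_iff_mem, A.mem_vI]
      rintro x rfl
      exact (hχ x).mpr rfl
    · rintro Q ⟨hQ, hle⟩ _ p hp
      rw [← MvPolynomial.IsPrime.vanishingIdeal_zeroLocus (K := K) Q,
        MvPolynomial.mem_vanishingIdeal_iff]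
      intro x hx
      rw [MvPolynomial.mem_zeroLocus_iff] at hx
      have hxχ : MvPolynomial.eval x χ = 0 :=
        hx χ (hle (Ideal.mem_sup_right (Ideal.mem_span_singleton_self χ)))
      have hxA : x ∈ A.carrier := by
        obtain ⟨S, hS⟩ := A.carrier_closed
        rw [hS]
        intro s hs
        refine hx s (hle (Ideal.mem_sup_left (A.mem_vI.mpr fun y _ => ?_)))
        have := A.pt_mem y
        rw [hS] at this
        exact this s hs
      have := (hχ ⟨x, hxA⟩).mp hxχ
      exact A.mem_vI.mp hp ⟨x, hxA⟩ this
  have hht := Ideal.map_height_le_one_of_mem_minimalPrimes hmin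
  set I := A.vI (Z 2).carrier with hI
  have hIm : I ≤ A.vI {z} := h21.le.trans h1m.le
  have hsurj : Function.Surjective (Ideal.Quotient.mk I) := Ideal.Quotient.mk_surjective
  have hc : ∀ J : Ideal (MvPolynomial (Fin A.n) K), I ≤ J →
      (J.map (Ideal.Quotient.mk I)).comap (Ideal.Quotient.mk I) = J := fun J hJ => by
    rw [Ideal.comap_map_of_surjective _ hsurj, ← RingHom.ker_eq_comap_bot, Ideal.mk_ker,
      sup_eq_left.mpr hJ]
  have hmlt : ∀ J J' : Ideal (MvPolynomial (Fin A.n) K), I ≤ J → J < J' →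
      J.map (Ideal.Quotient.mk I) < J'.map (Ideal.Quotient.mk I) := fun J J' hJ hJJ => by
    refine lt_of_le_not_ge (Ideal.map_mono hJJ.le) fun h => ?_
    have := Ideal.comap_mono (f := Ideal.Quotient.mk I) h
    rw [hc _ hJ, hc _ (hJ.trans hJJ.le)] at this
    exact absurd this (not_le_of_gt hJJ)
  have hpm : ∀ J : Ideal (MvPolynomial (Fin A.n) K), J.IsPrime → I ≤ J →
      (J.map (Ideal.Quotient.mk I)).IsPrime := fun J hJp hJ =>
    Ideal.map_isPrime_of_surjective hsurj (by rwa [Ideal.mk_ker])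
  have a2 := hpm I hP2 le_rfl
  have a1 := hpm Q1 hP1 h21.le
  have am := hpm _ hPm hIm
  have e1 := Ideal.height_add_one_le_of_lt_of_isPrime (hmlt I Q1 le_rfl h21)
  have e2 := Ideal.height_add_one_le_of_lt_of_isPrime (hmlt Q1 _ h21.le h1m)
  have e3 : (1 : ℕ∞) + 1 ≤ 1 := by
    calc (1 : ℕ∞) + 1 ≤ (Q1.map (Ideal.Quotient.mk I)).height + 1 := by
          gcongr
          exact le_trans le_add_self e1
      _ ≤ _ := e2
      _ ≤ 1 := hht
  exact absurd e3 (by decide)
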